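/- Let G = (V, E) be an Eulerian digraph, fix an edge e ∈ E with tail w, let T(G, w) be the number of oriented spanning trees of G rooted at w, and let ε(G, e) be the number of Eulerian tours of G starting with the edge e. Then ε(G, e) = T(G, w) · ∏_{v ∈ V} (d_v − 1)!. -/

import Mathlib

/-!
The BEST theorem (Holroyd et al., Corollary 4.10): the number of Eulerian tours of an
Eulerian digraph starting with a fixed edge `e` with tail `w` equals the number of
oriented spanning trees rooted at `w` times `∏_v (d_v − 1)!`.
-/

/-- The out-degree of a vertex. -/
def outdeg {V E : Type} [Fintype E] [DecidableEq V] (tail : E → V) (v : V) : ℕ :=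
  (Finset.univ.filter (fun e => tail e = v)).card

/-- The in-degree of a vertex. -/
def indeg {V E : Type} [Fintype E] [DecidableEq V] (head : E → V) (v : V) : ℕ :=
  (Finset.univ.filter (fun e => head e = v)).card

/-- The successor map of a candidate spanning tree rooted at `w`. -/
def treeSucc {V E : Type} [DecidableEq V] (head : E → V) (w : V)
    (ρ : {u : V // u ≠ w} → E) : V → V :=
  fun u => if h : u = w then u else head (ρ ⟨u, h⟩)

/-- An oriented spanning tree rooted at `w`: each vertex `u ≠ w` has exactly one
outgoing edge `ρ u`, `w` has none, and the edges `{ρ(u)}` contain no directed cycle. -/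
def IsOrientedSpanningTree {V E : Type} [DecidableEq V] (tail head : E → V) (w : V)
    (ρ : {u : V // u ≠ w} → E) : Prop :=
  (∀ u, tail (ρ u) = u.1) ∧
  ∀ (u : {u : V // u ≠ w}) (k : ℕ), 0 < k → (treeSucc head w ρ)^[k] u.1 ≠ u.1

/-- An Eulerian tour starting with the edge `e`, recorded as the sequence
`t 0 = e, t 1, …, t (m-1)` of the `m = |E|` edges in order of traversal: each edge is
used exactly once, consecutive edges are incident (the head of each edge is the tail
of the next), and the tour is closed (the head of the last edge is the tail of `e`). -/
def IsEulerianTourFrom {V E : Type} [Fintype E] (tail head : E → V) (e : E)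
    (t : Fin (Fintype.card E) → E) : Prop :=
  t ⟨0, Fintype.card_pos_iff.mpr ⟨e⟩⟩ = e ∧
  Function.Bijective t ∧
  ∀ k : Fin (Fintype.card E),
    head (t k) = tail (t ⟨(k.1 + 1) % Fintype.card E,
      Nat.mod_lt _ (Fintype.card_pos_iff.mpr ⟨e⟩)⟩)

/-- `r` numbers the out-edges of each vertex `v` from `0` to `outdeg v - 1`. -/
structure IsRanking {V E : Type} [Fintype E] [DecidableEq V] (tail : E → V) (r : E → ℕ) :
    Prop where
  lt : ∀ x, r x < outdeg tail (tail x)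
  inj : ∀ x y, tail x = tail y → r x = r y → x = y

theorem IsRanking.exists_eq {V E : Type} [Fintype E] [DecidableEq V] {tail : E → V}
    {r : E → ℕ} (h : IsRanking tail r) {v : V} {i : ℕ} (hi : i < outdeg tail v) :
    ∃ x, tail x = v ∧ r x = i := by
  have hsub : (Finset.univ.filter (fun x => tail x = v)).image r
      = Finset.range (outdeg tail v) := by
    apply Finset.eq_of_subset_of_card_le
    · intro j hj
      simp only [Finset.mem_image, Finset.mem_filter, Finset.mem_univ, true_and] at hj
      obtain ⟨x, rfl, rfl⟩ := hj
      exact Finset.mem_range.2 (h.lt x)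
    · rw [Finset.card_image_of_injOn, Finset.card_range]
      · rfl
      · intro x hx y hy hxy
        simp only [Finset.coe_filter, Finset.mem_univ, true_and, Set.mem_ofPred_eq] at hx hy
        exact h.inj x y (hx.trans hy.symm) hxy
  have hmem := Finset.mem_range.2 hi
  rw [← hsub] at hmem
  simpa using hmem

theorem card_equiv_apply_eq {A B : Type} [Fintype A] [Fintype B] [DecidableEq A]
    [DecidableEq B] (hAB : Fintype.card A = Fintype.card B) (a : A) (b : B) :
    Nat.card {π : A ≃ B // π a = b} = (Fintype.card B - 1).factorial := by
  let f : {π : A ≃ B // π a = b} ≃ {π : Option {x : A // x ≠ a} ≃ B // π none = b} :=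
    ((Equiv.optionSubtypeNe a).symm.equivCongr (Equiv.refl B)).subtypeEquiv
      (fun π => by simp [Equiv.equivCongr])
  have hA : Fintype.card {x : A // x ≠ a} = Fintype.card B - 1 := by
    rw [Fintype.card_subtype_compl, Fintype.card_subtype_eq, hAB]
  have hB : Fintype.card {y : B // y ≠ b} = Fintype.card B - 1 := by
    rw [Fintype.card_subtype_compl, Fintype.card_subtype_eq]
  rw [Nat.card_congr (f.trans (Equiv.optionSubtype b)), Nat.card_eq_fintype_card,
    Fintype.card_equiv (Fintype.equivOfCardEq (hA.trans hB.symm)), hA]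

theorem card_ranking {V E : Type} [Fintype V] [DecidableEq V] [Fintype E] [DecidableEq E]
    (tail : E → V) (a : V → E) (ha : ∀ v, tail (a v) = v) (i : V → ℕ)
    (hi : ∀ v, i v < outdeg tail v) :
    Nat.card {r : E → ℕ // IsRanking tail r ∧ ∀ v, r (a v) = i v}
      = ∏ v : V, Nat.factorial (outdeg tail v - 1) := by
  have hcard : ∀ v, Fintype.card {x // tail x = v} = Fintype.card (Fin (outdeg tail v)) := by
    intro v
    rw [Fintype.card_subtype, Fintype.card_fin, outdeg]
  let f : {r : E → ℕ // IsRanking tail r ∧ ∀ v, r (a v) = i v} ≃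
      ∀ v, {π : {x // tail x = v} ≃ Fin (outdeg tail v) // π ⟨a v, ha v⟩ = ⟨i v, hi v⟩} :=
    { toFun := fun r v =>
        ⟨Equiv.ofBijective (fun x => ⟨r.1 x.1, by have := r.2.1.lt x.1; rwa [x.2] at this⟩)
          ((Fintype.bijective_iff_injective_and_card _).2
            ⟨fun x y hxy => Subtype.ext (r.2.1.inj _ _ (x.2.trans y.2.symm)
              (by simpa using hxy)), hcard v⟩), by simp [r.2.2 v]⟩
      invFun := fun π =>
        ⟨fun x => ((π (tail x)).1 ⟨x, rfl⟩ : ℕ),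
          ⟨fun x => ((π (tail x)).1 ⟨x, rfl⟩).2, fun x y hxy h => by
            have key : ∀ v (hx : tail x = v) (hy : tail y = v),
                ((π v).1 ⟨x, hx⟩ : ℕ) = (π v).1 ⟨y, hy⟩ → x = y := fun v hx hy h =>
              congrArg Subtype.val ((π v).1.injective (Fin.ext h))
            refine key (tail y) hxy rfl ?_
            rw [← h]
            have : ∀ v (hx : tail x = v),
                ((π v).1 ⟨x, hx⟩ : ℕ) = (π (tail x)).1 ⟨x, rfl⟩ := by
              rintro v rfl; rfl
            exact this _ _⟩,
          fun v => by
            have : ∀ u (hu : tail (a v) = u),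
                ((π (tail (a v))).1 ⟨a v, rfl⟩ : ℕ) = (π u).1 ⟨a v, hu⟩ := by
              rintro u rfl; rfl
            exact (this v (ha v)).trans (by rw [(π v).2])⟩
      left_inv := fun r => by ext x; simp
      right_inv := fun π => by
        funext v
        apply Subtype.ext
        ext ⟨x, rfl⟩
        simp }
  rw [Nat.card_congr f, Nat.card_pi]
  refine Finset.prod_congr rfl fun v _ => ?_
  rw [card_equiv_apply_eq (hcard v), Fintype.card_fin]

theorem IsOrientedSpanningTree.exists_iterate_eq {V E : Type} [Finite V] [DecidableEq V]
    {tail head : E → V} {w : V} {ρ : {u : V // u ≠ w} → E}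
    (hρ : IsOrientedSpanningTree tail head w ρ) (v : V) :
    ∃ k, (treeSucc head w ρ)^[k] v = w := by
  obtain ⟨i, j, hij, h⟩ := Finite.exists_ne_map_eq_of_infinite
    (fun k : ℕ => (treeSucc head w ρ)^[k] v)
  wlog hlt : i < j generalizing i j
  · exact this j i hij.symm h.symm (by omega)
  refine ⟨i, by_contra fun hne => hρ.2 ⟨_, hne⟩ (j - i) (by omega) ?_⟩
  simp only at h ⊢
  rw [← Function.iterate_add_apply, Nat.sub_add_cancel hlt.le, h]

/-- The first `k` terms of `s` form a walk starting with `e` which leaves every vertex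
along its out-edges in the order prescribed by `r`. -/
structure IsRankedWalk {V E : Type} [DecidableEq V] (tail head : E → V) (r : E → ℕ) (e : E)
    (k : ℕ) (s : ℕ → E) : Prop where
  zero : s 0 = e
  step : ∀ j, j + 1 < k → head (s j) = tail (s (j + 1))
  rank : ∀ j < k, r (s j) = ((Finset.range j).filter (fun i => tail (s i) = tail (s j))).card

namespace IsRankedWalk

variable {V E : Type} [DecidableEq V] {tail head : E → V} {r : E → ℕ} {e : E}
  {k : ℕ} {s : ℕ → E}

theorem injOn (h : IsRankedWalk tail head r e k s) : Set.InjOn s (Finset.range k) := by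
  have key : ∀ i j, i < j → j < k → s i ≠ s j := by
    intro i j hij hj hs
    have h1 := h.rank i (hij.trans hj)
    rw [hs, h.rank j hj] at h1
    refine absurd h1 (ne_of_gt (Finset.card_lt_card ?_))
    rw [Finset.ssubset_iff_of_subset]
    · exact ⟨i, by simp [hij, hs], by simp⟩
    · intro l hl
      simp only [Finset.mem_filter, Finset.mem_range] at hl ⊢
      exact ⟨by omega, hl.2⟩
  intro i hi j hj hs
  simp only [Finset.coe_range, Set.mem_Iio] at hi hj
  rcases lt_trichotomy i j with hij | hij | hij
  · exact absurd hs (key i j hij hj)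
  · exact hij
  · exact absurd hs.symm (key j i hij hi)

theorem card_filter_image [DecidableEq E] (h : IsRankedWalk tail head r e k s)
    (p : E → Prop) [DecidablePred p] :
    (((Finset.range k).image s).filter p).card
      = ((Finset.range k).filter (fun i => p (s i))).card := by
  rw [Finset.filter_image, Finset.card_image_of_injOn]
  exact h.injOn.mono (Finset.coe_subset.2 (Finset.filter_subset _ _))

theorem card_filter_le [DecidableEq E] [Fintype E] (h : IsRankedWalk tail head r e k s)
    (p : E → Prop) [DecidablePred p] :
    ((Finset.range k).filter (fun i => p (s i))).card ≤ (Finset.univ.filter p).card := by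
  rw [← h.card_filter_image p]
  exact Finset.card_le_card (Finset.filter_subset_filter _ (Finset.subset_univ _))

theorem exists_of_card_eq [DecidableEq E] [Fintype E] (h : IsRankedWalk tail head r e k s)
    (p : E → Prop) [DecidablePred p]
    (hp : ((Finset.range k).filter (fun i => p (s i))).card = (Finset.univ.filter p).card)
    {x : E} (hx : p x) : ∃ i < k, s i = x := by
  rw [← h.card_filter_image p] at hp
  have heq := Finset.eq_of_subset_of_card_le
    (Finset.filter_subset_filter p (Finset.subset_univ ((Finset.range k).image s))) hp.ge
  have hmem : x ∈ Finset.univ.filter p := by simp [hx]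
  rw [← heq] at hmem
  simpa using (Finset.mem_filter.1 hmem).1

theorem card_head_add (s : ℕ → E) (k : ℕ) (h : ∀ j < k, head (s j) = tail (s (j + 1)))
    (v : V) :
    ((Finset.range (k + 1)).filter (fun i => head (s i) = v)).card
        + (if tail (s 0) = v then 1 else 0)
      = ((Finset.range (k + 1)).filter (fun i => tail (s i) = v)).card
        + (if head (s k) = v then 1 else 0) := by
  induction k with
  | zero =>
    simp only [zero_add, Finset.range_one, Finset.filter_singleton]
    split_ifs <;> simp
  | succ k ih =>
    have ih := ih (fun j hj => h j (by omega))
    rw [h k (by omega)] at ih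
    rw [Finset.card_filter, Finset.card_filter] at ih ⊢
    rw [Finset.sum_range_succ _ (k + 1), Finset.sum_range_succ _ (k + 1)]
    linarith

end IsRankedWalk

theorem exists_isRankedWalk {V E : Type} [Finite V] [DecidableEq V] [Fintype E]
    [DecidableEq E] {tail head : E → V} (hbal : ∀ v : V, indeg head v = outdeg tail v)
    {e : E} {w : V} (hw : tail e = w) {ρ : {u : V // u ≠ w} → E}
    (hρ : IsOrientedSpanningTree tail head w ρ) {r : E → ℕ} (hr : IsRanking tail r)
    (hre : r e = 0) (hrρ : ∀ u, r (ρ u) + 1 = outdeg tail u.1) (k : ℕ)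
    (hk : k + 1 ≤ Fintype.card E) : ∃ s, IsRankedWalk tail head r e (k + 1) s := by
  induction k with
  | zero =>
    refine ⟨fun _ => e, rfl, fun j hj => absurd hj (by omega), fun j hj => ?_⟩
    obtain rfl : j = 0 := by omega
    simp [hre]
  | succ k ih =>
    obtain ⟨s, hs⟩ := ih (by omega)
    have hcount := IsRankedWalk.card_head_add s k (fun j hj => hs.step j (by omega))
      (tail := tail) (head := head)
    rw [hs.zero, hw] at hcount
    have hin : ∀ v, _ ≤ indeg head v := fun v => hs.card_filter_le (fun x => head x = v)
    have hout : ∀ v, _ ≤ outdeg tail v := fun v => hs.card_filter_le (fun x => tail x = v)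
    rcases (hout (head (s k))).lt_or_eq with hlt | heq
    · obtain ⟨y, hy, hry⟩ := hr.exists_eq hlt
      have hold : ∀ j < k + 1, Function.update s (k + 1) y j = s j := fun j hj =>
        Function.update_of_ne (by omega) _ _
      refine ⟨Function.update s (k + 1) y, ?_, fun j hj => ?_, fun j hj => ?_⟩
      · rw [hold 0 (by omega), hs.zero]
      · rw [hold j (by omega)]
        rcases Nat.lt_or_ge (j + 1) (k + 1) with hj' | hj'
        · rw [hold _ hj', hs.step j hj']
        · obtain rfl : j = k := by omega
          rw [Function.update_self, hy]
      · have hfilter : ∀ v, (Finset.range j).filter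
            (fun i => tail (Function.update s (k + 1) y i) = v)
            = (Finset.range j).filter (fun i => tail (s i) = v) := fun v =>
          Finset.filter_congr fun i hi => by
            rw [hold i (by have := Finset.mem_range.1 hi; omega)]
        rw [hfilter]
        rcases Nat.lt_or_ge j (k + 1) with hj' | hj'
        · rw [hold j hj', hs.rank j hj']
        · obtain rfl : j = k + 1 := by omega
          rw [Function.update_self, hry, hy]
    · exfalso
      have hkw : w = head (s k) := by
        by_contra hne
        have h1 := hcount (head (s k))
        have h2 := hin (head (s k))
        rw [if_neg hne, if_pos rfl, heq] at h1
        rw [hbal] at h2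
        omega
      rw [← hkw] at heq hcount
      have hclosed : ∀ v, _ = _ := fun v => Nat.add_right_cancel (hcount v)
      have hback : ∀ v,
          ((Finset.range (k + 1)).filter
            (fun i => tail (s i) = treeSucc head w ρ v)).card
            = outdeg tail (treeSucc head w ρ v) →
          ((Finset.range (k + 1)).filter (fun i => tail (s i) = v)).card
            = outdeg tail v := by
        intro v hv
        by_cases hvw : v = w
        · rw [hvw]; exact heq
        rw [treeSucc, dif_neg hvw] at hv
        rw [← hclosed, ← hbal] at hv
        obtain ⟨j, hj, hsj⟩ := hs.exists_of_card_eq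
          (fun x => head x = head (ρ ⟨v, hvw⟩)) hv rfl
        have h1 := hs.rank j hj
        have h2 := hrρ ⟨v, hvw⟩
        rw [hsj, hρ.1 ⟨v, hvw⟩] at h1
        refine le_antisymm (hout v) ?_
        rw [← h2, h1, Nat.succ_le_iff]
        refine Finset.card_lt_card ((Finset.ssubset_iff_of_subset ?_).2 ⟨j, ?_, by simp⟩)
        · intro l hl
          simp only [Finset.mem_filter, Finset.mem_range] at hl ⊢
          exact ⟨by omega, hl.2⟩
        · simp [hj, hsj, hρ.1 ⟨v, hvw⟩]
      have hfull : ∀ n v, (treeSucc head w ρ)^[n] v = w →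
          ((Finset.range (k + 1)).filter (fun i => tail (s i) = v)).card
            = outdeg tail v := by
        intro n
        induction n with
        | zero => intro v hv; rw [show v = w from hv]; exact heq
        | succ n ih => exact fun v hv => hback v (ih _ hv)
      have hsurj : (Finset.univ : Finset E) ⊆ (Finset.range (k + 1)).image s := by
        intro x _
        obtain ⟨n, hn⟩ := hρ.exists_iterate_eq (tail x)
        obtain ⟨j, hj, hsj⟩ := hs.exists_of_card_eq
          (fun y => tail y = tail x) (hfull n _ hn) rfl
        exact Finset.mem_image.2 ⟨j, Finset.mem_range.2 hj, hsj⟩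
      have := (Finset.card_le_card hsurj).trans Finset.card_image_le
      rw [Finset.card_univ, Finset.card_range] at this
      omega

/-- The rank of the edge `x` among the edges with the same tail, in order of traversal
by the tour `t`. -/
noncomputable def tourRank {V E : Type} [Fintype E] [DecidableEq V] (tail : E → V)
    (t : Fin (Fintype.card E) → E) (ht : Function.Bijective t) (x : E) : ℕ :=
  (Finset.univ.filter
    (fun i => i < (Equiv.ofBijective t ht).symm x ∧ tail (t i) = tail x)).card

section tourRank

variable {V E : Type} [Fintype E] [DecidableEq V] {tail head : E → V}
  {t : Fin (Fintype.card E) → E} (ht : Function.Bijective t)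

theorem tourRank_apply (j : Fin (Fintype.card E)) :
    tourRank tail t ht (t j)
      = (Finset.univ.filter (fun i => i < j ∧ tail (t i) = tail (t j))).card := by
  rw [tourRank, Equiv.ofBijective_symm_apply_apply]

theorem tourRank_lt_iff {i j : Fin (Fintype.card E)} (h : tail (t i) = tail (t j)) :
    tourRank tail t ht (t i) < tourRank tail t ht (t j) ↔ i < j := by
  have key : ∀ {i j : Fin (Fintype.card E)}, i < j → tail (t i) = tail (t j) →
      tourRank tail t ht (t i) < tourRank tail t ht (t j) := by
    intro i j hij h
    rw [tourRank_apply, tourRank_apply]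
    refine Finset.card_lt_card ((Finset.ssubset_iff_of_subset ?_).2 ⟨i, ?_, by simp⟩)
    · intro l hl
      simp only [Finset.mem_filter, Finset.mem_univ, true_and] at hl ⊢
      exact ⟨hl.1.trans hij, hl.2.trans h⟩
    · simp [hij, h]
  refine ⟨fun hlt => ?_, fun hij => key hij h⟩
  rcases lt_trichotomy i j with hij | rfl | hij
  · exact hij
  · exact absurd hlt (lt_irrefl _)
  · exact absurd (key hij h.symm) hlt.asymm

theorem isRanking_tourRank : IsRanking tail (tourRank tail t ht) where
  lt x := by
    obtain ⟨j, rfl⟩ := ht.2 x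
    classical
    rw [tourRank_apply, outdeg, ← Finset.card_image_of_injective _ ht.1]
    refine Finset.card_lt_card ((Finset.ssubset_iff_of_subset ?_).2 ⟨t j, by simp, ?_⟩)
    · intro y hy
      simp only [Finset.mem_image, Finset.mem_filter, Finset.mem_univ, true_and] at hy ⊢
      obtain ⟨i, hi, rfl⟩ := hy
      exact hi.2
    · simp [ht.1.eq_iff]
  inj x y hxy h := by
    obtain ⟨i, rfl⟩ := ht.2 x
    obtain ⟨j, rfl⟩ := ht.2 y
    have h1 := (tourRank_lt_iff ht hxy).not.1 h.not_lt
    have h2 := (tourRank_lt_iff ht hxy.symm).not.1 h.symm.not_lt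
    rw [le_antisymm (not_lt.1 h2) (not_lt.1 h1)]

theorem isOrientedSpanningTree_of_tour {e : E} (hE : IsEulerianTourFrom tail head e t)
    {w : V} (hw : tail e = w) {ρ : {u : V // u ≠ w} → E} (hρ : ∀ u, tail (ρ u) = u.1)
    (hlast : ∀ u, tourRank tail t ht (ρ u) + 1 = outdeg tail u.1) :
    IsOrientedSpanningTree tail head w ρ := by
  refine ⟨hρ, ?_⟩
  choose τ hτ using fun u => ht.2 (ρ u)
  have hstep : ∀ u (h : head (ρ u) ≠ w), τ u < τ ⟨head (ρ u), h⟩ := by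
    intro u h
    have hs := hE.2.2 (τ u)
    rw [hτ] at hs
    have hne : (τ u).1 + 1 ≠ Fintype.card E := by
      intro heq
      apply h
      simp only [heq, Nat.mod_self] at hs
      rw [hs, hE.1, hw]
    have hlt : (τ u).1 + 1 < Fintype.card E := by have := (τ u).2; omega
    simp only [Nat.mod_eq_of_lt hlt] at hs
    by_contra hcon
    have hlt' : τ ⟨head (ρ u), h⟩ < ⟨(τ u).1 + 1, hlt⟩ := by
      rw [Fin.lt_def] at hcon ⊢
      simp only
      omega
    have htail : tail (t (τ ⟨head (ρ u), h⟩)) = tail (t ⟨(τ u).1 + 1, hlt⟩) := by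
      rw [hτ, hρ, ← hs]
    have h1 := (tourRank_lt_iff ht htail).2 hlt'
    have h2 := (isRanking_tourRank (tail := tail) ht).lt (t ⟨(τ u).1 + 1, hlt⟩)
    have h3 := hlast ⟨head (ρ u), h⟩
    rw [← hs] at h2
    rw [hτ] at h1
    simp only at h3
    omega
  have hw_fix : ∀ k, (treeSucc head w ρ)^[k] w = w := fun k =>
    Function.iterate_fixed (by simp [treeSucc]) k
  have hiter : ∀ k (u : {u : V // u ≠ w}) (h : (treeSucc head w ρ)^[k + 1] u.1 ≠ w),
      τ u < τ ⟨_, h⟩ := by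
    intro k
    induction k with
    | zero =>
      intro u h
      have hu : (treeSucc head w ρ)^[0 + 1] u.1 = head (ρ u) := by
        simp [treeSucc, u.2]
      simp only [hu] at h ⊢
      exact hstep u h
    | succ k ih =>
      intro u h
      have hu : treeSucc head w ρ u.1 = head (ρ u) := by simp [treeSucc, u.2]
      have hne : head (ρ u) ≠ w := by
        intro hh
        apply h
        rw [Function.iterate_succ_apply, hu, hh, hw_fix]
      have heq : (treeSucc head w ρ)^[k + 1 + 1] u.1
          = (treeSucc head w ρ)^[k + 1] (head (ρ u)) := by
        rw [Function.iterate_succ_apply, hu]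
      simp only [heq] at h ⊢
      exact (hstep u hne).trans (ih ⟨_, hne⟩ h)
  intro u k hk hcyc
  obtain ⟨k, rfl⟩ : ∃ l, k = l + 1 := ⟨k - 1, by omega⟩
  have := hiter k u (by rw [hcyc]; exact u.2)
  simp only [hcyc] at this
  exact lt_irrefl _ this

theorem tour_eq_of_tourRank_eq {e : E} {t' : Fin (Fintype.card E) → E}
    (ht' : Function.Bijective t') (hE : IsEulerianTourFrom tail head e t)
    (hE' : IsEulerianTourFrom tail head e t')
    (h : tourRank tail t ht = tourRank tail t' ht') : t = t' := by
  have key : ∀ n (hn : n < Fintype.card E), t ⟨n, hn⟩ = t' ⟨n, hn⟩ := by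
    intro n
    induction n using Nat.strong_induction_on with
    | _ n ih =>
      intro hn
      rcases n with _ | n
      · exact hE.1.trans hE'.1.symm
      have h1 := hE.2.2 ⟨n, by omega⟩
      have h2 := hE'.2.2 ⟨n, by omega⟩
      simp only [Nat.mod_eq_of_lt hn] at h1 h2
      have htail : tail (t ⟨n + 1, hn⟩) = tail (t' ⟨n + 1, hn⟩) := by
        rw [← h1, ← h2, ih n (by omega)]
      refine (isRanking_tourRank ht).inj _ _ htail ?_
      conv_rhs => rw [h]
      rw [tourRank_apply, tourRank_apply]
      congr 1
      refine Finset.filter_congr fun i _ => and_congr_right fun hi => ?_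
      rw [htail, ih i.1 hi i.2]
  exact funext fun j => key j.1 j.2

end tourRank

theorem exists_tour {V E : Type} [Finite V] [DecidableEq V] [Fintype E]
    [DecidableEq E] {tail head : E → V} (hbal : ∀ v : V, indeg head v = outdeg tail v)
    {e : E} {w : V} (hw : tail e = w) {ρ : {u : V // u ≠ w} → E}
    (hρ : IsOrientedSpanningTree tail head w ρ) {r : E → ℕ} (hr : IsRanking tail r)
    (hre : r e = 0) (hrρ : ∀ u, r (ρ u) + 1 = outdeg tail u.1) :
    ∃ t, ∃ hE : IsEulerianTourFrom tail head e t, tourRank tail t hE.2.1 = r := by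
  have hpos : 0 < Fintype.card E := Fintype.card_pos_iff.2 ⟨e⟩
  obtain ⟨k, hk⟩ : ∃ k, Fintype.card E = k + 1 := ⟨Fintype.card E - 1, by omega⟩
  obtain ⟨s, hs⟩ := exists_isRankedWalk hbal hw hρ hr hre hrρ k hk.ge
  have hbij : Function.Bijective (fun i : Fin (Fintype.card E) => s i) := by
    refine (Fintype.bijective_iff_injective_and_card _).2 ⟨fun i j hij => ?_, by simp⟩
    exact Fin.ext (hs.injOn (by have := i.2; simp; omega) (by have := j.2; simp; omega) hij)
  have hall : ∀ (p : E → Prop) [DecidablePred p],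
      ((Finset.range (k + 1)).filter (fun i => p (s i))).card
        = (Finset.univ.filter p).card := by
    intro p _
    rw [← hs.card_filter_image]
    congr 2
    apply Finset.eq_univ_of_card
    rw [Finset.card_image_of_injOn hs.injOn, Finset.card_range, hk]
  have hclose : head (s k) = w := by
    have h1 := IsRankedWalk.card_head_add s k (fun j hj => hs.step j (by omega))
      (tail := tail) (head := head) (head (s k))
    have h2 := hbal (head (s k))
    rw [hall (fun x => head x = head (s k)), hall (fun x => tail x = head (s k)),
      hs.zero, hw, if_pos rfl] at h1
    rw [indeg, outdeg] at h2
    by_contra hne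
    rw [if_neg (Ne.symm hne)] at h1
    omega
  refine ⟨fun i => s i, ⟨hs.zero, hbij, fun j => ?_⟩, ?_⟩
  · rcases Nat.lt_or_ge (j.1 + 1) (Fintype.card E) with hj | hj
    · simp only [Nat.mod_eq_of_lt hj]
      exact hs.step _ (by omega)
    · have hj' : j.1 + 1 = Fintype.card E := by have := j.2; omega
      simp only [hj', Nat.mod_self]
      obtain hjk : j.1 = k := by omega
      rw [hjk, hclose, hs.zero, hw]
  · funext x
    obtain ⟨j, rfl⟩ := hbij.2 x
    rw [tourRank_apply hbij j]
    simp only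
    rw [hs.rank j (by have := j.2; omega)]
    refine Finset.card_bij (fun i _ => i.1) ?_ (fun i _ l _ h => Fin.ext h) ?_
    · intro i hi
      simp only [Finset.mem_filter, Finset.mem_univ, true_and, Finset.mem_range] at hi ⊢
      exact hi
    · intro i hi
      simp only [Finset.mem_filter, Finset.mem_range] at hi
      exact ⟨⟨i, hi.1.trans j.2⟩, Finset.mem_filter.2 ⟨Finset.mem_univ _, hi⟩, rfl⟩

/-- **BEST theorem.**  Let `G = (V, E)` be an Eulerian digraph, let `e ∈ E` be an
edge with tail `w`, let `T(G, w)` be the number of oriented spanning trees of `G`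
rooted at `w`, and let `ε(G, e)` be the number of Eulerian tours of `G` starting with
the edge `e`.  Then `ε(G, e) = T(G, w) · ∏_{v ∈ V} (d_v − 1)!`. -/
theorem eulerian_tour_count
    {V E : Type} [Fintype V] [DecidableEq V] [Fintype E] [DecidableEq E]
    (tail head : E → V)
    (hsc : ∀ u v : V,
      Relation.ReflTransGen (fun a b => ∃ e, tail e = a ∧ head e = b) u v)
    (hbal : ∀ v : V, indeg head v = outdeg tail v)
    (e : E) (w : V) (hw : tail e = w) :
    Nat.card {t : Fin (Fintype.card E) → E // IsEulerianTourFrom tail head e t}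
      = Nat.card {ρ : {u : V // u ≠ w} → E // IsOrientedSpanningTree tail head w ρ} *
        ∏ v : V, Nat.factorial (outdeg tail v - 1) := by
  have hpos : ∀ v, 0 < outdeg tail v := by
    intro v
    have hedge : ∃ x, tail x = v := by
      rcases Relation.ReflTransGen.cases_head (hsc v w) with h | ⟨_, ⟨x, hx, _⟩, _⟩
      · exact ⟨e, hw.trans h.symm⟩
      · exact ⟨x, hx⟩
    obtain ⟨x, hx⟩ := hedge
    exact Finset.card_pos.2 ⟨x, by simp [hx]⟩
  let T := {ρ : {u : V // u ≠ w} → E // IsOrientedSpanningTree tail head w ρ}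
  let R := fun ρ : T => {r : E → ℕ // IsRanking tail r ∧ r e = 0 ∧
    ∀ u, r (ρ.1 u) + 1 = outdeg tail u.1}
  have hR : ∀ ρ : T, Nat.card (R ρ) = ∏ v : V, Nat.factorial (outdeg tail v - 1) := by
    intro ρ
    rw [← card_ranking tail (fun v => if h : v = w then e else ρ.1 ⟨v, h⟩)
      (fun v => by
        by_cases h : v = w
        · simp [h, hw]
        · simp [h, ρ.2.1])
      (fun v => if v = w then 0 else outdeg tail v - 1)
      (fun v => by
        have := hpos v
        split_ifs <;> omega)]
    refine Nat.card_congr (Equiv.subtypeEquivRight fun r => and_congr_right fun _ => ?_)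
    constructor
    · rintro ⟨h1, h2⟩ v
      by_cases h : v = w
      · simp [h, h1]
      · have := h2 ⟨v, h⟩
        simp only [h, dite_false, if_false]
        simp only at this
        omega
    · intro h
      refine ⟨by simpa using h w, fun u => ?_⟩
      have h1 := h u.1
      have h2 := hpos u.1
      rw [dif_neg u.2, if_neg u.2] at h1
      rw [h1]
      omega
  have hlast : ∀ t : {t // IsEulerianTourFrom tail head e t}, ∀ u : {u : V // u ≠ w},
      ∃ x, tail x = u.1 ∧ tourRank tail t.1 t.2.2.1 x = outdeg tail u.1 - 1 := fun t u =>
    (isRanking_tourRank t.2.2.1).exists_eq (by have := hpos u.1; omega)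
  choose ρ hρt hρr using hlast
  have hρr' : ∀ t u, tourRank tail t.1 t.2.2.1 (ρ t u) + 1 = outdeg tail u.1 := by
    intro t u
    have := hpos u.1
    rw [hρr]
    omega
  let F : {t // IsEulerianTourFrom tail head e t} → (Σ ρ : T, R ρ) := fun t =>
    ⟨⟨ρ t, isOrientedSpanningTree_of_tour t.2.2.1 t.2 hw (hρt t) (hρr' t)⟩,
      ⟨tourRank tail t.1 t.2.2.1, isRanking_tourRank t.2.2.1, by
        refine (congrArg _ t.2.1.symm).trans ((tourRank_apply t.2.2.1 _).trans ?_)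
        simp [Fin.lt_def], hρr' t⟩⟩
  have hF : Function.Bijective F := by
    constructor
    · intro t t' h
      exact Subtype.ext (tour_eq_of_tourRank_eq t.2.2.1 t'.2.2.1 t.2 t'.2
        (congrArg (fun p => p.2.1) h))
    · rintro ⟨σ, r, hr, hre, hrσ⟩
      obtain ⟨t, hE, htr⟩ := exists_tour hbal hw σ.2 hr hre hrσ
      refine ⟨⟨t, hE⟩, Sigma.subtype_ext (Subtype.ext (funext fun u => ?_)) htr⟩
      refine hr.inj _ _ ((hρt ⟨t, hE⟩ u).trans (σ.2.1 u).symm) ?_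
      have h1 := hρr' ⟨t, hE⟩ u
      have h2 := hrσ u
      simp only [htr] at h1
      exact Nat.add_right_cancel (h1.trans h2.symm)
  have : Finite T := Subtype.finite
  have : Fintype T := Fintype.ofFinite T
  have : ∀ σ : T, Finite (R σ) := fun σ => Nat.finite_of_card_ne_zero (by
    rw [hR]
    exact Finset.prod_ne_zero_iff.2 fun v _ => Nat.factorial_ne_zero _)
  rw [Nat.card_congr (Equiv.ofBijective F hF), Nat.card_sigma, Finset.sum_congr rfl
    (fun σ _ => hR σ), Finset.sum_const, Finset.card_univ, smul_eq_mul,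
    ← Nat.card_eq_fintype_card]
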